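/- arXiv:2309.01667 — 3 statements merged into one kernel-verified Lean document; each statement's English description precedes it below -/
import Mathlib

section
/- Perfect hiding of Pedersen-type commitments: let G be a finite group and h ∈ G with orderOf h = Fintype.card G. Then for any two elements c₀, c₁ ∈ G (e.g., c_b = g^{m_b} for two different committed messages), the distribution of c₀ · h^{k.val} and the distribution of c₁ · h^{k.val}, for k uniformly random in ZMod (Fintype.card G), are equal as probability mass functions: PMF.map (fun k => c₀ * h ^ k.val) (PMF.uniformOfFintype (ZMod (Fintype.card G))) = PMF.map (fun k => c₁ * h ^ k.val) (PMF.uniformOfFintype (ZMod (Fintype.card G))). -/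
theorem PMF.map_uniformOfFintype_of_bijective {α β : Type*} [Fintype α] [Nonempty α]
    [Fintype β] [Nonempty β] {f : α → β} (hf : Function.Bijective f) :
    (PMF.uniformOfFintype α).map f = PMF.uniformOfFintype β := by
  classical
  ext b
  obtain ⟨a, rfl⟩ := hf.surjective b
  simp [PMF.map_apply, hf.injective.eq_iff, Fintype.card_of_bijective hf]

theorem bijective_mul_pow_zmod_val {G : Type*} [Group G] [Fintype G]
    {h : G} (hh : orderOf h = Fintype.card G) (c : G) :
    Function.Bijective fun k : ZMod (Fintype.card G) => c * h ^ k.val := by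
  refine (Fintype.bijective_iff_injective_and_card _).2 ⟨fun k l hkl => ?_, ZMod.card _⟩
  have hlt (m : ZMod (Fintype.card G)) : m.val < orderOf h := (ZMod.val_lt m).trans_eq hh.symm
  exact ZMod.val_injective _ (pow_injOn_Iio_orderOf (hlt k) (hlt l) (mul_left_cancel hkl))

/-- Perfect hiding of Pedersen-type commitments: if `h` generates the finite group `G`
(`orderOf h = Fintype.card G`), then for any `c₀ c₁ : G`, the distributions of
`c₀ * h ^ k.val` and `c₁ * h ^ k.val` for `k` uniform in `ZMod (Fintype.card G)` coincide. -/
theorem pedersen_perfect_hiding {G : Type*} [Group G] [Fintype G]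
    (h : G) (hh : orderOf h = Fintype.card G) (c₀ c₁ : G) :
    PMF.map (fun k : ZMod (Fintype.card G) => c₀ * h ^ k.val)
        (PMF.uniformOfFintype (ZMod (Fintype.card G))) =
      PMF.map (fun k : ZMod (Fintype.card G) => c₁ * h ^ k.val)
        (PMF.uniformOfFintype (ZMod (Fintype.card G))) := by
  rw [PMF.map_uniformOfFintype_of_bijective (bijective_mul_pow_zmod_val hh c₀),
    PMF.map_uniformOfFintype_of_bijective (bijective_mul_pow_zmod_val hh c₁)]
end

section
/- Breaking the binding of a Pedersen commitment yields the discrete logarithm: let p be a prime, G a group, g ∈ G with orderOf g = p, s ∈ ZMod p, and set h = g^{s.val}. If m₁, m₂, r₁, r₂ ∈ ZMod p satisfy m₁ ≠ m₂ and g^{m₁.val} · h^{r₁.val} = g^{m₂.val} · h^{r₂.val}, then r₁ ≠ r₂ and s = (m₁ − m₂) · (r₂ − r₁)⁻¹ in the field ZMod p. -/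
/-- Breaking the binding of a Pedersen commitment yields the discrete logarithm:
with `h = g ^ s.val` and `orderOf g = p` prime, any two openings `(m₁, r₁)`, `(m₂, r₂)`
of the same commitment with `m₁ ≠ m₂` satisfy `r₁ ≠ r₂` and reveal
`s = (m₁ - m₂) * (r₂ - r₁)⁻¹` in the field `ZMod p`. -/
theorem pedersen_binding_break_extracts_dlog {G : Type*} [Group G]
    (p : ℕ) [Fact p.Prime] (g : G) (hg : orderOf g = p) (s : ZMod p)
    (h : G) (hh : h = g ^ s.val)
    (m₁ m₂ r₁ r₂ : ZMod p) (hm : m₁ ≠ m₂)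
    (hcom : g ^ m₁.val * h ^ r₁.val = g ^ m₂.val * h ^ r₂.val) :
    r₁ ≠ r₂ ∧ s = (m₁ - m₂) * (r₂ - r₁)⁻¹ := by
  have key : m₁ + s * r₁ = m₂ + s * r₂ := by
    rw [hh, ← pow_mul, ← pow_mul, ← pow_add, ← pow_add, pow_eq_pow_iff_modEq, hg,
      ← ZMod.natCast_eq_natCast_iff] at hcom
    simpa using hcom
  have hr : r₁ ≠ r₂ := by
    rintro rfl
    exact hm (add_right_cancel key)
  refine ⟨hr, ?_⟩
  rw [eq_mul_inv_iff_mul_eq₀ (sub_ne_zero.mpr hr.symm)]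
  linear_combination -key
end

section
/- Correctness of the rerandomized proof-of-knowledge form of a Pointcheval–Sanders signature: let e : G₁ →* (G₂ →* G_T) be a bilinear pairing, σ₁, σ₂ ∈ G₁, X̃, Ỹ, g̃ ∈ G₂, and m a natural number, and assume the verification equation e(σ₁)(X̃) · (e(σ₁)(Ỹ))^m = e(σ₂)(g̃) holds. Then for all natural numbers r and t, the rerandomized pair σ′ = (σ′₁, σ′₂) = (σ₁^r, (σ₂ · σ₁^t)^r) satisfies e(σ′₁)(X̃) · (e(σ′₁)(Ỹ))^m · (e(σ′₁)(g̃))^t = e(σ′₂)(g̃). -/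
/-- Correctness of the rerandomized proof-of-knowledge form of a Pointcheval–Sanders
signature (here `Xt, Yt, gt` denote `X̃, Ỹ, g̃ ∈ G₂`): if
`e(σ₁)(X̃) · (e(σ₁)(Ỹ))^m = e(σ₂)(g̃)`, then for all `r t`, the rerandomized pair
`σ′ = (σ₁^r, (σ₂ · σ₁^t)^r)` satisfies
`e(σ′₁)(X̃) · (e(σ′₁)(Ỹ))^m · (e(σ′₁)(g̃))^t = e(σ′₂)(g̃)`. -/
theorem ps_rerandomized_pok_correct {G₁ G₂ GT : Type*}
    [CommGroup G₁] [CommGroup G₂] [CommGroup GT]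
    (e : G₁ →* (G₂ →* GT)) (σ₁ σ₂ : G₁) (Xt Yt gt : G₂) (m : ℕ)
    (hver : e σ₁ Xt * (e σ₁ Yt) ^ m = e σ₂ gt) (r t : ℕ) :
    e (σ₁ ^ r) Xt * (e (σ₁ ^ r) Yt) ^ m * (e (σ₁ ^ r) gt) ^ t =
      e ((σ₂ * σ₁ ^ t) ^ r) gt := by
  simp only [map_pow, map_mul, MonoidHom.pow_apply, MonoidHom.mul_apply, ← hver, mul_pow,
    ← pow_mul, Nat.mul_comm]
end
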